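/- arXiv:2104.14717 — 2 statements merged into one kernel-verified Lean document; each statement's English description precedes it below -/
import Mathlib

section
/- Let 1 ≤ p < ∞ and let h : ℝ → ℝ be a Schwartz function. Then for any sequence of real numbers λ_n with λ_n → ∞, lim_{n→∞} ‖h(·) cos(λ_n ·)‖_{L^p(ℝ)} = ( (1/(2π)) ∫_0^{2π} |cos x|^p dx )^{1/p} · ‖h‖_{L^p(ℝ)}. -/
noncomputable section

open MeasureTheory Filter Topology Real Set
open scoped FourierTransform ENNReal

/-- A Littlewood–Paley pair `(χ, ψ)`: smooth functions valued in `[0,1]`,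
with `χ` supported in `{|ξ| ≤ 4/3}`, `ψ` supported in `{3/4 ≤ |ξ| ≤ 8/3}`,
and `χ(ξ) + ∑_{j ≥ 0} ψ(2⁻ʲ ξ) = 1` for all `ξ`. -/
structure LPPair where
  χ : ℝ → ℝ
  ψ : ℝ → ℝ
  smooth_chi : ContDiff ℝ (⊤ : ℕ∞) χ
  smooth_psi : ContDiff ℝ (⊤ : ℕ∞) ψ
  mem_chi : ∀ ξ, χ ξ ∈ Set.Icc (0:ℝ) 1
  mem_psi : ∀ ξ, ψ ξ ∈ Set.Icc (0:ℝ) 1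
  supp_chi : ∀ ξ, χ ξ ≠ 0 → |ξ| ≤ 4/3
  supp_psi : ∀ ξ, ψ ξ ≠ 0 → 3/4 ≤ |ξ| ∧ |ξ| ≤ 8/3
  sum_one : ∀ ξ, χ ξ + ∑' j : ℕ, ψ ((2:ℝ) ^ (-(j:ℤ)) * ξ) = 1

/-- The nonhomogeneous dyadic block `Δ_j u`. -/
def LPPair.block (P : LPPair) (j : ℤ) (u : ℝ → ℂ) : ℝ → ℂ :=
  if j ≤ -2 then 0
  else if j = -1 then 𝓕⁻ (fun ξ => (P.χ ξ : ℂ) * 𝓕 u ξ)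
  else 𝓕⁻ (fun ξ => (P.ψ ((2:ℝ) ^ (-j) * ξ) : ℂ) * 𝓕 u ξ)

/-- The `ℓ^r(ℤ)`-norm of a family of extended nonnegative reals. -/
def lnorm (r : ℝ≥0∞) (a : ℤ → ℝ≥0∞) : ℝ≥0∞ :=
  if r = ∞ then ⨆ j, a j else (∑' j, a j ^ r.toReal) ^ (1 / r.toReal)

/-- The nonhomogeneous Besov norm `‖u‖_{B^s_{p,r}}` of a complex-valued function. -/
def LPPair.besovNorm (P : LPPair) (s : ℝ) (p r : ℝ≥0∞) (u : ℝ → ℂ) : ℝ≥0∞ :=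
  lnorm r (fun j => ENNReal.ofReal ((2:ℝ) ^ ((j : ℝ) * s)) * eLpNorm (P.block j u) p volume)

/-- The nonhomogeneous Besov norm of a real-valued function. -/
def LPPair.besovNormR (P : LPPair) (s : ℝ) (p r : ℝ≥0∞) (u : ℝ → ℝ) : ℝ≥0∞ :=
  P.besovNorm s p r (fun x => (u x : ℂ))

/-- `‖u, v‖_X := (‖u‖_X² + ‖v‖_X²)^{1/2}` . -/
def pairNorm (a b : ℝ≥0∞) : ℝ≥0∞ := (a ^ 2 + b ^ 2) ^ (1/2 : ℝ)

/-- The `C^{0,1}` (bounded Lipschitz) norm `‖u‖_{L^∞} + ‖∂_x u‖_{L^∞}`. -/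
def lipNorm (u : ℝ → ℝ) : ℝ≥0∞ :=
  eLpNorm u ∞ volume + eLpNorm (deriv u) ∞ volume

/-- The Green function `G(x) = e^{-|x|}/2` of `(1-∂_x²)⁻¹`. -/
def Gker (x : ℝ) : ℝ := Real.exp (-|x|) / 2

/-- Convolution with the Green function, i.e. `(1-∂_x²)⁻¹`. -/
def convG (f : ℝ → ℝ) : ℝ → ℝ := fun x => ∫ y, Gker (x - y) * f y

/-- `P(u) = -∂_x (1-∂_x²)⁻¹ ( ((2k-1)/2) u^{k-1} (∂_x u)² + u^{k+1} )`. -/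
def Pop (k : ℕ) (u : ℝ → ℝ) : ℝ → ℝ :=
  fun x => - deriv (convG (fun y =>
    ((2*(k:ℝ)-1)/2) * u y ^ (k-1) * (deriv u y) ^ 2 + u y ^ (k+1))) x

/-- `J(u) = -(1-∂_x²)⁻¹ ( ((k-1)/2) u^{k-2} (∂_x u)³ )`. -/
def Jop (k : ℕ) (u : ℝ → ℝ) : ℝ → ℝ :=
  fun x => - convG (fun y => (((k:ℝ)-1)/2) * u y ^ (k-2) * (deriv u y) ^ 3) x

/-- `u : [0,T] × ℝ → ℝ` solves the generalized Camassa–Holm–Novikov equation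
`∂_t u + u^k ∂_x u = P(u) + J(u)` with initial datum `u₀`. -/
def IsSolution (k : ℕ) (T : ℝ) (u : ℝ → ℝ → ℝ) (u0 : ℝ → ℝ) : Prop :=
  u 0 = u0 ∧ ∀ t ∈ Set.Icc (0:ℝ) T, ∀ x : ℝ,
    HasDerivAt (fun τ => u τ x)
      (Pop k (u t) x + Jop k (u t) x - (u t x) ^ k * deriv (u t) x) t


/-- Two-pi is positive, as a `Fact`, for use with `AddCircle (2 * π)`. -/
theorem osc_fact_two_pi_pos : Fact (0 < 2 * π) := ⟨Real.two_pi_pos⟩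

attribute [local instance] osc_fact_two_pi_pos

/-- Bounded continuous oscillating factors preserve integrability. -/
theorem osc_integrable (G : ℝ → ℂ) (hG : Integrable G) (f : C(AddCircle (2 * π), ℂ)) (l : ℝ) :
    Integrable (fun x : ℝ => f ((l * x : ℝ) : AddCircle (2 * π)) * G x) := by
  refine hG.bdd_mul (c := ‖f‖) ?_ (ae_of_all _ fun x => f.norm_coe_le_norm _)
  refine Continuous.aestronglyMeasurable ?_
  exact f.continuous.comp ((AddCircle.continuous_mk' _).comp (continuous_const.mul continuous_id))

theorem osc_integrable_circle (f : C(AddCircle (2 * π), ℂ)) :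
    Integrable (fun t => f t) (AddCircle.haarAddCircle (T := 2 * π)) :=
  f.continuous.integrable_of_hasCompactSupport (HasCompactSupport.of_compactSpace _)

theorem osc_fourier (G : ℝ → ℂ) (lam : ℕ → ℝ)
    (hlam : Tendsto lam atTop atTop) (k : ℤ) :
    Tendsto (fun n => ∫ x : ℝ, fourier k ((lam n * x : ℝ) : AddCircle (2 * π)) * G x) atTop
      (𝓝 ((∫ t, fourier k t ∂(AddCircle.haarAddCircle (T := 2 * π))) * ∫ x, G x)) := by
  by_cases hk : k = 0
  · subst hk
    simp
  · have h0 : (∫ t, fourier k t ∂(AddCircle.haarAddCircle (T := 2 * π))) = 0 := by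
      have := congrFun (fourierCoeff_fourier (T := 2 * π) k) 0
      rw [Pi.single_eq_of_ne (Ne.symm hk)] at this
      simpa [fourierCoeff] using this
    rw [h0, zero_mul]
    have hk' : (k : ℝ) ≠ 0 := by exact_mod_cast hk
    have hw : Tendsto (fun n => lam n * (-(k : ℝ) / (2 * π))) atTop (cocompact ℝ) := by
      have hne : -(k : ℝ) / (2 * π) ≠ 0 :=
        div_ne_zero (neg_ne_zero.mpr hk') Real.two_pi_pos.ne'
      have h1 : Tendsto lam atTop (cocompact ℝ) := hlam.mono_right atTop_le_cocompact
      exact (Homeomorph.mulRight₀ _ hne).isClosedEmbedding.tendsto_cocompact.comp h1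
    refine ((Real.tendsto_integral_exp_smul_cocompact G).comp hw).congr fun n => ?_
    refine integral_congr_ae (ae_of_all _ fun x => ?_)
    simp only [Circle.smul_def, smul_eq_mul, Real.fourierChar_apply, fourier_coe_apply]
    congr 2
    have : (π : ℂ) ≠ 0 := by exact_mod_cast Real.pi_ne_zero
    push_cast
    field_simp

theorem osc_span (G : ℝ → ℂ) (hG : Integrable G) (lam : ℕ → ℝ)
    (hlam : Tendsto lam atTop atTop) (f : C(AddCircle (2 * π), ℂ))
    (hf : f ∈ Submodule.span ℂ (range (@fourier (2 * π)))) :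
    Tendsto (fun n => ∫ x : ℝ, f ((lam n * x : ℝ) : AddCircle (2 * π)) * G x) atTop
      (𝓝 ((∫ t, f t ∂(AddCircle.haarAddCircle (T := 2 * π))) * ∫ x, G x)) := by
  induction hf using Submodule.span_induction with
  | mem f hf =>
    obtain ⟨k, rfl⟩ := hf
    exact osc_fourier G lam hlam k
  | zero => simp
  | add f g _ _ hf hg =>
    simp only [ContinuousMap.add_apply, add_mul]
    rw [integral_add (osc_integrable_circle f) (osc_integrable_circle g), add_mul]
    refine (hf.add hg).congr fun n => ?_
    rw [integral_add (osc_integrable G hG f _) (osc_integrable G hG g _)]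
  | smul c f _ hf =>
    simp only [ContinuousMap.smul_apply, smul_eq_mul, mul_assoc, integral_const_mul]
    exact hf.const_mul c

theorem osc_main (G : ℝ → ℂ) (hG : Integrable G) (lam : ℕ → ℝ)
    (hlam : Tendsto lam atTop atTop) (f : C(AddCircle (2 * π), ℂ)) :
    Tendsto (fun n => ∫ x : ℝ, f ((lam n * x : ℝ) : AddCircle (2 * π)) * G x) atTop
      (𝓝 ((∫ t, f t ∂(AddCircle.haarAddCircle (T := 2 * π))) * ∫ x, G x)) := by
  rw [Metric.tendsto_atTop]
  intro ε hε
  set M : ℝ := ∫ x, ‖G x‖ with hM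
  have hM0 : 0 ≤ M := integral_nonneg fun _ => norm_nonneg _
  set δ : ℝ := ε / (3 * (M + 1)) with hδ
  have hδ0 : 0 < δ := by positivity
  have hδM : δ * M < ε / 3 := by
    have : δ * (M + 1) = ε / 3 := by rw [hδ]; field_simp
    nlinarith
  have hmem : f ∈ closure (Submodule.span ℂ (range (@fourier (2 * π))) : Set _) := by
    rw [← Submodule.topologicalClosure_coe, span_fourier_closure_eq_top]
    trivial
  obtain ⟨g, hg, hfg⟩ := Metric.mem_closure_iff.mp hmem δ hδ0
  rw [dist_eq_norm] at hfg
  obtain ⟨N, hN⟩ := Metric.tendsto_atTop.mp (osc_span G hG lam hlam g hg) (ε / 3) (by positivity)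
  refine ⟨N, fun n hn => ?_⟩
  have h1 : dist (∫ x : ℝ, f ((lam n * x : ℝ) : AddCircle (2 * π)) * G x)
      (∫ x : ℝ, g ((lam n * x : ℝ) : AddCircle (2 * π)) * G x) ≤ δ * M := by
    rw [dist_eq_norm, ← integral_sub (osc_integrable G hG f _) (osc_integrable G hG g _), hM,
      ← integral_const_mul]
    refine norm_integral_le_of_norm_le (hG.norm.const_mul _) (ae_of_all _ fun x => ?_)
    rw [← sub_mul, norm_mul]
    gcongr
    exact ((f - g).norm_coe_le_norm _).trans hfg.le
  have h2 : dist ((∫ t, g t ∂(AddCircle.haarAddCircle (T := 2 * π))) * ∫ x, G x)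
      ((∫ t, f t ∂(AddCircle.haarAddCircle (T := 2 * π))) * ∫ x, G x) ≤ δ * M := by
    rw [dist_comm, dist_eq_norm, ← sub_mul,
      ← integral_sub (osc_integrable_circle f) (osc_integrable_circle g), norm_mul]
    refine mul_le_mul ?_ (norm_integral_le_integral_norm _) (norm_nonneg _) hδ0.le
    refine (norm_integral_le_of_norm_le_const (C := δ) (ae_of_all _ fun x => ?_)).trans ?_
    · exact ((f - g).norm_coe_le_norm _).trans hfg.le
    · simp
  have h3 := hN n hn
  have h4 := dist_triangle4 (∫ x : ℝ, f ((lam n * x : ℝ) : AddCircle (2 * π)) * G x)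
    (∫ x : ℝ, g ((lam n * x : ℝ) : AddCircle (2 * π)) * G x)
    ((∫ t, g t ∂(AddCircle.haarAddCircle (T := 2 * π))) * ∫ x, G x)
    ((∫ t, f t ∂(AddCircle.haarAddCircle (T := 2 * π))) * ∫ x, G x)
  linarith

theorem osc_real (g : ℝ → ℝ) (hg : Integrable g) (lam : ℕ → ℝ)
    (hlam : Tendsto lam atTop atTop) (φ : ℝ → ℝ) (hφ : Continuous φ)
    (hper : Function.Periodic φ (2 * π)) :
    Tendsto (fun n => ∫ x : ℝ, φ (lam n * x) * g x) atTop
      (𝓝 ((1 / (2 * π) * ∫ t in (0 : ℝ)..(2 * π), φ t) * ∫ x, g x)) := by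
  have hper' : Function.Periodic (fun x => (φ x : ℂ)) (2 * π) := fun x => by simp [hper x]
  have hc : Continuous (hper'.lift : AddCircle (2 * π) → ℂ) :=
    continuous_coinduced_dom.mpr (Complex.continuous_ofReal.comp hφ)
  have key := osc_main (fun x => (g x : ℂ)) hg.ofReal lam hlam ⟨hper'.lift, hc⟩
  rw [AddCircle.integral_haarAddCircle, ← AddCircle.intervalIntegral_preimage (2 * π) 0] at key
  simp only [ContinuousMap.coe_mk, Function.Periodic.lift_coe, zero_add,
    intervalIntegral.integral_ofReal, integral_complex_ofReal, ← Complex.ofReal_mul] at key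
  have key2 := (Complex.continuous_re.tendsto _).comp key
  simpa [Function.comp_def, one_div] using key2

theorem oscillation_Lp_limit
    (p : ℝ) (hp : 1 ≤ p) (h : SchwartzMap ℝ ℝ) (lam : ℕ → ℝ)
    (hlam : Filter.Tendsto lam Filter.atTop Filter.atTop) :
    Filter.Tendsto
      (fun n => (eLpNorm (fun x => h x * Real.cos (lam n * x)) (ENNReal.ofReal p) volume).toReal)
      Filter.atTop
      (nhds ((1/(2*π) * ∫ x in (0:ℝ)..(2*π), |Real.cos x| ^ p) ^ (1/p) *
        (eLpNorm (fun x => h x) (ENNReal.ofReal p) volume).toReal)) := by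
  have hp0 : 0 < p := by linarith
  have hP0 : ENNReal.ofReal p ≠ 0 := by simpa using hp0
  have hPt : ENNReal.ofReal p ≠ ∞ := ENNReal.ofReal_ne_top
  have hPr : (ENNReal.ofReal p).toReal = p := ENNReal.toReal_ofReal hp0.le
  have hmem : MemLp (fun x => h x) (ENNReal.ofReal p) volume := h.memLp _ _
  have hmem2 : ∀ n, MemLp (fun x => h x * Real.cos (lam n * x)) (ENNReal.ofReal p) volume := by
    intro n
    refine hmem.of_le ?_ (ae_of_all _ fun x => ?_)
    · exact (h.continuous.mul (by fun_prop)).aestronglyMeasurable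
    · rw [norm_mul]
      exact mul_le_of_le_one_right (norm_nonneg _) (Real.abs_cos_le_one _)
  have hint : Integrable (fun x => ‖h x‖ ^ p) := by
    simpa [hPr] using hmem.integrable_norm_rpow hP0 hPt
  have hcos : Continuous (fun x => |Real.cos x| ^ p) :=
    (Real.continuous_cos.abs).rpow_const fun _ => Or.inr hp0.le
  have hlim := osc_real _ hint lam hlam (fun x => |Real.cos x| ^ p) hcos
    (fun x => by simp [Real.cos_add_two_pi])
  have hI0 : 0 ≤ 1/(2*π) * ∫ x in (0:ℝ)..(2*π), |Real.cos x| ^ p := by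
    refine mul_nonneg (by positivity) (intervalIntegral.integral_nonneg Real.two_pi_pos.le ?_)
    intro x _
    positivity
  have hJ0 : 0 ≤ ∫ x, ‖h x‖ ^ p := integral_nonneg fun _ => by positivity
  rw [hmem.eLpNorm_eq_integral_rpow_norm hP0 hPt, hPr,
    ENNReal.toReal_ofReal (by positivity), ← one_div, ← Real.mul_rpow hI0 hJ0]
  refine (hlim.rpow_const (p := 1 / p) (Or.inr (by positivity))).congr fun n => ?_
  rw [(hmem2 n).eLpNorm_eq_integral_rpow_norm hP0 hPt, hPr,
    ENNReal.toReal_ofReal (Real.rpow_nonneg (integral_nonneg fun _ => by positivity) _), ← one_div]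
  congr 2
  funext x
  rw [norm_mul, Real.mul_rpow (norm_nonneg _) (norm_nonneg _), mul_comm, Real.norm_eq_abs (Real.cos _)]

end
end

section
/- Let k ≥ 1 be an integer, s ∈ ℝ, 1 ≤ p < ∞, and let f_n, g_n be the high/low frequency functions built from the profile φ. Then lim_{n→∞} 2^{ns} ‖g_n^k ∂_x f_n‖_{L^p(ℝ)} = (12/17)^{k−1} · ( (1/(2π)) ∫_0^{2π} |cos x|^p dx )^{1/p} · ‖φ^{k+1}‖_{L^p(ℝ)} > 0. Consequently, for any r ∈ [1,∞], liminf_{n→∞} ‖g_n^k ∂_x f_n‖_{B^s_{p,r}} > 0. -/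
noncomputable section

open MeasureTheory Filter Topology Real Set
open scoped FourierTransform ENNReal

/-- The high-frequency part `f_n(x) = 2^{-ns} φ(x) sin((17/12) 2^n x)`. -/
def fHigh (s : ℝ) (φ : ℝ → ℝ) (n : ℕ) : ℝ → ℝ :=
  fun x => (2:ℝ) ^ (-((n:ℝ) * s)) * φ x * Real.sin (17/12 * (2:ℝ) ^ n * x)

/-- The low-frequency part `g_n(x) = (12/17) 2^{-n/k} φ(x)`. -/
def gLow (k : ℕ) (φ : ℝ → ℝ) (n : ℕ) : ℝ → ℝ :=
  fun x => 12/17 * (2:ℝ) ^ (-((n:ℝ)/(k:ℝ))) * φ x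

/-- The product `g_n^k ∂_x f_n`. -/
def hfun (k : ℕ) (s : ℝ) (φ : ℝ → ℝ) (n : ℕ) : ℝ → ℝ :=
  fun x => gLow k φ n x ^ k * deriv (fHigh s φ n) x

lemma aux_cont_cos (p : ℝ) (hp : 1 ≤ p) : Continuous (fun x : ℝ => |Real.cos x| ^ p) := by
  have h0 : 0 ≤ p := by linarith
  exact (Real.continuous_cos.abs).rpow_const (fun x => Or.inr h0)

lemma aux_bdd (w : ℝ → ℝ) (hw : Continuous w) (hper : Function.Periodic w (2*π))
    (m : ℝ) (hm : m = 1/(2*π) * ∫ x in (0:ℝ)..(2*π), w x) :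
    ∃ (W : ℝ → ℝ) (C : ℝ), Continuous W ∧ (∀ x, HasDerivAt W (w x - m) x) ∧ ∀ x, |W x| ≤ C := by
  have hc : Continuous (fun x => w x - m) := by fun_prop
  have hper' : Function.Periodic (fun x => w x - m) (2*π) := by
    intro x; simp only; rw [hper x]
  have hd : ∀ x, HasDerivAt (fun y => ∫ t in (0:ℝ)..y, (w t - m)) (w x - m) x := fun x =>
    intervalIntegral.integral_hasDerivAt_right (hc.intervalIntegrable _ _)
      (hc.stronglyMeasurableAtFilter _ _) hc.continuousAt
  have hcont : Continuous (fun y => ∫ t in (0:ℝ)..y, (w t - m)) :=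
    continuous_iff_continuousAt.2 fun x => (hd x).continuousAt
  have h0 : ∫ t in (0:ℝ)..(2*π), (w t - m) = 0 := by
    rw [intervalIntegral.integral_sub (hw.intervalIntegrable _ _) (by simp), hm]
    simp only [intervalIntegral.integral_const, smul_eq_mul]
    field_simp
    ring
  have hP : Function.Periodic (fun y => ∫ t in (0:ℝ)..y, (w t - m)) (2*π) := by
    intro x
    simp only
    have := hper'.intervalIntegral_add_eq x 0
    rw [zero_add, h0] at this
    rw [← intervalIntegral.integral_add_adjacent_intervals (hc.intervalIntegrable 0 x)
      (hc.intervalIntegrable x (x + 2*π)), this, add_zero]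
  have hb := hP.isBounded_of_continuous (by positivity) hcont
  obtain ⟨C, hC⟩ := hb.exists_norm_le
  exact ⟨_, C, hcont, hd, fun x => hC _ ⟨x, rfl⟩⟩

lemma aux_pow_le (M y q : ℝ) (hy : |y| ≤ M) (hq : 1 < q) :
    |y| ^ q ≤ M ^ (q-1) * |y| := by
  have h1 : |y| ^ q = |y| ^ (q-1) * |y| := by
    rcases eq_or_lt_of_le (abs_nonneg y) with h | h
    · rw [← h]; rw [Real.zero_rpow (by linarith)]; simp
    · rw [← Real.rpow_add_one h.ne']; ring_nf
  rw [h1]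
  gcongr

lemma aux_bound (Φ : SchwartzMap ℝ ℝ) : ∃ M, 0 ≤ M ∧ ∀ x, |Φ x| ≤ M := by
  refine ⟨‖Φ.toBoundedContinuousFunction‖, norm_nonneg _, fun x => ?_⟩
  exact Φ.toBoundedContinuousFunction.norm_coe_le_norm x

lemma aux_osc (Φ : SchwartzMap ℝ ℝ) (p q : ℝ) (hp : 1 ≤ p) (hq : 1 < q) (l : ℕ → ℝ)
    (hl0 : ∀ n, 0 < l n) (hl : Tendsto l atTop atTop) :
    Tendsto (fun n => ∫ x, |Φ x| ^ q * |Real.cos (l n * x)| ^ p) atTop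
      (nhds ((1/(2*π) * ∫ x in (0:ℝ)..(2*π), |Real.cos x| ^ p) * ∫ x, |Φ x| ^ q)) := by
  set m := 1/(2*π) * ∫ x in (0:ℝ)..(2*π), |Real.cos x| ^ p with hm
  have hp0 : 0 ≤ p := by linarith
  have hq0 : 0 ≤ q := by linarith
  obtain ⟨W, C, hWc, hWd, hWb⟩ := aux_bdd _ (aux_cont_cos p hp)
    (by intro x; simp [Real.cos_add_two_pi]) m hm
  obtain ⟨M, hM0, hM⟩ := aux_bound Φ
  set G := fun x => |Φ x| ^ q with hG
  set G' := fun x => q * |Φ x| ^ (q-2) * Φ x * deriv Φ x with hG'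
  have hGd : ∀ x, HasDerivAt G (G' x) x := fun x =>
    (hasDerivAt_abs_rpow (Φ x) hq).comp x (Φ.hasDerivAt x)
  have hGc : Continuous G := continuous_iff_continuousAt.2 fun x => (hGd x).continuousAt
  have hGi : Integrable G := by
    refine (Φ.integrable.norm.const_mul (M^(q-1))).mono' hGc.aestronglyMeasurable ?_
    refine ae_of_all _ fun x => ?_
    rw [Real.norm_of_nonneg (by positivity)]
    exact aux_pow_le M _ q (hM x) hq
  have hG'eq : G' = deriv G := funext fun x => (hGd x).deriv.symm
  have hG'm : AEStronglyMeasurable G' volume := by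
    rw [hG'eq]; exact (measurable_deriv G).aestronglyMeasurable
  have hG'i : Integrable G' := by
    have hi : Integrable (fun x => deriv Φ x) := (SchwartzMap.derivCLM ℝ ℝ Φ).integrable
    refine (hi.norm.const_mul (q * M^(q-1))).mono' hG'm ?_
    refine ae_of_all _ fun x => ?_
    simp only [hG', norm_mul, Real.norm_eq_abs]
    rw [abs_of_nonneg hq0, abs_of_nonneg (by positivity : 0 ≤ |Φ x| ^ (q-2))]
    have : |Φ x| ^ (q-2) * |Φ x| ≤ M ^ (q-1) := by
      rcases eq_or_lt_of_le (abs_nonneg (Φ x)) with h | h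
      · rw [← h]; simp; positivity
      · rw [← Real.rpow_add_one h.ne']
        rw [show q - 2 + 1 = q - 1 by ring]
        exact Real.rpow_le_rpow (abs_nonneg _) (hM x) (by linarith)
    calc q * |Φ x| ^ (q-2) * |Φ x| * |deriv Φ x|
        = q * (|Φ x| ^ (q-2) * |Φ x|) * |deriv Φ x| := by ring
      _ ≤ _ := by gcongr
  have hcosm : ∀ n, AEStronglyMeasurable (fun x => |Real.cos (l n * x)| ^ p) volume := fun n =>
    ((aux_cont_cos p hp).comp (continuous_const.mul continuous_id)).aestronglyMeasurable
  have hcosb : ∀ y, |(|Real.cos y| ^ p)| ≤ 1 := fun y => by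
    rw [abs_of_nonneg (by positivity)]
    exact Real.rpow_le_one (abs_nonneg _) (Real.abs_cos_le_one _) hp0
  have hWm : ∀ n, AEStronglyMeasurable (fun x => (l n)⁻¹ * W (l n * x)) volume := fun n =>
    (by fun_prop : Continuous (fun x => (l n)⁻¹ * W (l n * x))).aestronglyMeasurable
  have hWb' : ∀ n x, ‖(l n)⁻¹ * W (l n * x)‖ ≤ (l n)⁻¹ * C := fun n x => by
    rw [norm_mul, Real.norm_of_nonneg (inv_nonneg.2 (hl0 n).le)]
    have := hWb (l n * x)
    have h2 := (inv_nonneg.2 (hl0 n).le)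
    gcongr
    exact this
  have hI1 : ∀ n, Integrable (fun x => G x * |Real.cos (l n * x)| ^ p) := fun n =>
    hGi.mul_bdd (c := 1) (hcosm n) (ae_of_all _ fun x => hcosb _)
  have key : ∀ n, ∫ x, G x * |Real.cos (l n * x)| ^ p = m * (∫ x, G x)
      - ∫ x, G' x * ((l n)⁻¹ * W (l n * x)) := by
    intro n
    have hv : ∀ x, HasDerivAt (fun x => (l n)⁻¹ * W (l n * x))
        (|Real.cos (l n * x)| ^ p - m) x := by
      intro x
      have h1 : HasDerivAt (fun x => l n * x) (l n) x := by
        simpa using (hasDerivAt_id x).const_mul (l n)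
      have h2 := ((hWd (l n * x)).comp x h1).const_mul ((l n)⁻¹)
      have : (l n)⁻¹ * ((|Real.cos (l n * x)| ^ p - m) * l n) = |Real.cos (l n * x)| ^ p - m := by
        field_simp [(hl0 n).ne']
      rw [this] at h2
      exact h2
    have := integral_mul_deriv_eq_deriv_mul_of_integrable (u := G) (u' := G')
      (v := fun x => (l n)⁻¹ * W (l n * x)) (v' := fun x => |Real.cos (l n * x)| ^ p - m)
      (fun x _ => hGd x) (fun x _ => hv x)
      (by
        have := (hI1 n).sub (hGi.mul_const m)
        refine this.congr (ae_of_all _ fun x => ?_)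
        simp; ring)
      (hG'i.mul_bdd (hWm n) (ae_of_all _ (hWb' n)))
      (hGi.mul_bdd (hWm n) (ae_of_all _ (hWb' n)))
    simp only [mul_sub] at this
    rw [integral_sub (hI1 n) (hGi.mul_const m), integral_mul_const] at this
    linarith
  have hlim : Tendsto (fun n => ∫ x, G' x * ((l n)⁻¹ * W (l n * x))) atTop (nhds 0) := by
    refine squeeze_zero_norm (a := fun n => (l n)⁻¹ * (C * ∫ x, ‖G' x‖)) (fun n => ?_) ?_
    · calc _ ≤ ∫ x, (l n)⁻¹ * C * ‖G' x‖ := by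
            refine norm_integral_le_of_norm_le (hG'i.norm.const_mul _) (ae_of_all _ fun x => ?_)
            rw [norm_mul, mul_comm]
            exact mul_le_mul_of_nonneg_right (hWb' n x) (norm_nonneg _)
        _ = _ := by rw [integral_const_mul]; ring
    · simpa using (tendsto_inv_atTop_zero.comp hl).mul_const (C * ∫ x, ‖G' x‖)
  refine Tendsto.congr (fun n => (key n).symm) ?_
  simpa only [sub_zero] using tendsto_const_nhds.sub hlim

lemma aux_norm_add {p : ℝ≥0∞} (hp : 1 ≤ p) (f g : ℝ → ℝ) (hf : MemLp f p volume)
    (hg : MemLp g p volume) :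
    |(eLpNorm (f + g) p volume).toReal - (eLpNorm f p volume).toReal| ≤
      (eLpNorm g p volume).toReal := by
  have : Fact (1 ≤ p) := ⟨hp⟩
  have := abs_norm_sub_norm_le ((hf.add hg).toLp _) (hf.toLp _)
  rw [← MemLp.toLp_sub] at this
  simpa [Lp.norm_toLp] using this

lemma aux_norm_eq (p : ℝ) (hp : 1 ≤ p) (f : ℝ → ℝ) (hf : MemLp f (ENNReal.ofReal p) volume) :
    (eLpNorm f (ENNReal.ofReal p) volume).toReal = (∫ x, |f x| ^ p) ^ (1/p) := by
  have hp0 : 0 < p := by linarith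
  rw [hf.eLpNorm_eq_integral_rpow_norm (by simpa using hp0) (by simp)]
  rw [ENNReal.toReal_ofReal (by positivity), ENNReal.toReal_ofReal hp0.le]
  simp

lemma aux_cospos (p : ℝ) (hp : 1 ≤ p) :
    0 < 1/(2*π) * ∫ x in (0:ℝ)..(2*π), |Real.cos x| ^ p := by
  have hpi := Real.pi_pos
  have : 0 < ∫ x in (0:ℝ)..(2*π), |Real.cos x| ^ p := by
    refine intervalIntegral.integral_pos (by positivity) (aux_cont_cos p hp).continuousOn
      (fun x _ => by positivity) ⟨0, ⟨le_rfl, by positivity⟩, by simp⟩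
  positivity

lemma aux_schw_pow (Φ : SchwartzMap ℝ ℝ) (k : ℕ) : ∃ V : SchwartzMap ℝ ℝ, ∀ x, V x = Φ x ^ (k+1) := by
  induction k with
  | zero => exact ⟨Φ, by simp⟩
  | succ k ih =>
    obtain ⟨V, hV⟩ := ih
    refine ⟨SchwartzMap.pairing (ContinuousLinearMap.mul ℝ ℝ) V Φ, fun x => ?_⟩
    simp [SchwartzMap.pairing_apply_apply, hV, pow_succ]

lemma aux_pos (Φ : SchwartzMap ℝ ℝ) (k : ℕ) (p : ℝ) (hp : 1 ≤ p)
    (h0 : 𝓕 (fun x => (Φ x : ℂ)) (0:ℝ) ≠ 0) :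
    0 < (eLpNorm (fun x => Φ x ^ (k+1)) (ENNReal.ofReal p) volume).toReal := by
  obtain ⟨V, hV⟩ := aux_schw_pow Φ k
  have hVe : (fun x => Φ x ^ (k+1)) = V := funext fun x => (hV x).symm
  have hm : MemLp V (ENNReal.ofReal p) volume := V.memLp _ _
  rw [hVe]
  refine ENNReal.toReal_pos ?_ hm.2.ne
  intro h
  rw [eLpNorm_eq_zero_iff hm.1 (by simp; linarith)] at h
  apply h0
  rw [Real.fourier_congr_ae (f₂ := fun _ => 0)]
  · simp [Real.fourier_eq]
  · filter_upwards [h] with x hx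
    rw [hV] at hx
    have := pow_eq_zero_iff (n := k+1) (by simp) |>.1 hx
    simp [this]

lemma aux_fourier_mul (u v : SchwartzMap ℝ ℂ) (R S : ℝ)
    (hu : ∀ ξ, 𝓕 (fun x => u x) ξ ≠ 0 → |ξ| ≤ R) (hv : ∀ ξ, 𝓕 (fun x => v x) ξ ≠ 0 → |ξ| ≤ S) :
    ∀ ξ, 𝓕 (fun x => u x * v x) ξ ≠ 0 → |ξ| ≤ R + S := by
  intro ξ hξ
  by_contra hcon
  push Not at hcon
  apply hξ
  have h1 : 𝓕⁻ (SchwartzMap.pairing (ContinuousLinearMap.mul ℂ ℂ) u v) =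
      SchwartzMap.convolution (ContinuousLinearMap.mul ℂ ℂ) (𝓕⁻ u) (𝓕⁻ v) := by
    simp [SchwartzMap.convolution]
  have h2 : 𝓕 (fun x => u x * v x) ξ =
      (𝓕⁻ (SchwartzMap.pairing (ContinuousLinearMap.mul ℂ ℂ) u v)) (-ξ) := by
    rw [SchwartzMap.fourierInv_coe, Real.fourierInv_eq_fourier_neg, neg_neg]
    congr 1
  rw [h2, h1, SchwartzMap.convolution_apply]
  unfold MeasureTheory.convolution
  apply integral_eq_zero_of_ae
  refine ae_of_all _ fun t => ?_
  simp only [ContinuousLinearMap.mul_apply', Pi.zero_apply]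
  rw [SchwartzMap.fourierInv_coe, SchwartzMap.fourierInv_coe, Real.fourierInv_eq_fourier_neg,
    Real.fourierInv_eq_fourier_neg]
  by_contra hne
  have ha := hu _ (left_ne_zero_of_mul hne)
  have hb := hv _ (right_ne_zero_of_mul hne)
  rw [abs_le] at ha hb
  rw [lt_abs] at hcon
  rcases hcon with h | h <;> linarith [ha.1, ha.2, hb.1, hb.2]

lemma aux_cpow (Φ : SchwartzMap ℝ ℝ) (hΦ : ∀ ξ, 𝓕 (fun x => (Φ x : ℂ)) ξ ≠ 0 → |ξ| ≤ 1/2) (k : ℕ) :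
    ∃ U : SchwartzMap ℝ ℂ, (∀ x, U x = (Φ x : ℂ) ^ (k+1)) ∧
      ∀ ξ, 𝓕 (fun x => U x) ξ ≠ 0 → |ξ| ≤ ((k:ℝ)+1)/2 := by
  let Φc : SchwartzMap ℝ ℂ := Φ.postcompCLM (𝕜 := ℝ) Complex.ofRealCLM
  have hΦc : ∀ x, Φc x = (Φ x : ℂ) := fun x => rfl
  induction k with
  | zero => exact ⟨Φc, by simp [hΦc], by simpa [hΦc] using hΦ⟩
  | succ k ih =>
    obtain ⟨V, hV, hV'⟩ := ih
    refine ⟨SchwartzMap.pairing (ContinuousLinearMap.mul ℂ ℂ) V Φc, fun x => ?_, fun ξ hξ => ?_⟩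
    · simp [SchwartzMap.pairing_apply_apply, hV, hΦc, pow_succ]
    · have := aux_fourier_mul V Φc _ (1/2) hV' (by simpa [hΦc] using hΦ) ξ
        (by simpa [SchwartzMap.pairing_apply_apply] using hξ)
      push_cast
      linarith

lemma aux_mod (W : ℝ → ℂ) (l ξ : ℝ) :
    𝓕 (fun x : ℝ => Complex.exp ((l * x : ℝ) * Complex.I) * W x) ξ = 𝓕 W (ξ - l / (2*π)) := by
  rw [Real.fourier_real_eq_integral_exp_smul, Real.fourier_real_eq_integral_exp_smul]
  congr 1
  ext x
  rw [smul_eq_mul, smul_eq_mul, ← mul_assoc, ← Complex.exp_add]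
  congr 2
  have : (-2 * π * x * (ξ - l/(2*π)) : ℝ) = -2 * π * x * ξ + l * x := by
    field_simp
    ring
  rw [this]
  push_cast
  ring

lemma aux_fourierInv_cont (f : ℝ → ℂ) (hf : Integrable f) : Continuous (𝓕⁻ f) := by
  have h : 𝓕⁻ f = fun w => 𝓕 f (-w) := funext fun w => Real.fourierInv_eq_fourier_neg f w
  rw [h]
  have : Continuous (𝓕 f) := VectorFourier.fourierIntegral_continuous Real.continuous_fourierChar
    (innerSL ℝ).continuous₂ hf
  exact this.comp continuous_neg

lemma aux_sum (P : LPPair) (N : ℕ) (hN : 1 ≤ N) (ξ : ℝ) (h1 : (2:ℝ)^(N+3)/6 < |ξ|)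
    (h2 : |ξ| < 3/8 * (2:ℝ)^(N+3)) :
    P.ψ ((2:ℝ) ^ (-((N:ℤ)+1)) * ξ) + P.ψ ((2:ℝ) ^ (-(N:ℤ)) * ξ) = 1 := by
  have hchi : P.χ ξ = 0 := by
    by_contra h
    have := P.supp_chi ξ h
    have h3 : (2:ℝ)^1 ≤ 2^N := pow_le_pow_right₀ (by norm_num) hN
    rw [pow_add] at h1
    linarith
  have hs := P.sum_one ξ
  rw [hchi, zero_add, tsum_eq_sum (s := {N+1, N})] at hs
  · rw [Finset.sum_pair (by simp)] at hs
    push_cast at hs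
    exact hs
  · intro j hj
    by_contra h
    obtain ⟨ha, hb⟩ := P.supp_psi _ h
    rw [zpow_neg, zpow_natCast, abs_mul, abs_inv, abs_of_pos (by positivity : (0:ℝ) < 2^j)] at ha hb
    have hpos : (0:ℝ) < 2^j := by positivity
    rw [inv_mul_eq_div, le_div_iff₀ hpos] at ha
    rw [inv_mul_eq_div, div_le_iff₀ hpos] at hb
    have e1 : (2:ℝ)^(j+1) < 2^(N+3) := by rw [pow_succ]; linarith
    have e2 : (2:ℝ)^(N+3) < 2^(j+4) := by rw [pow_add _ j]; linarith
    have e1' := (pow_lt_pow_iff_right₀ (by norm_num : (1:ℝ) < 2)).1 e1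
    have e2' := (pow_lt_pow_iff_right₀ (by norm_num : (1:ℝ) < 2)).1 e2
    simp at hj
    omega

lemma aux_psi_int (P : LPPair) (c : ℝ) (F : ℝ → ℂ) (hF : Integrable F) :
    Integrable (fun ξ => (P.ψ (c * ξ) : ℂ) * F ξ) := by
  have hc : Continuous (fun ξ => (P.ψ (c * ξ) : ℂ)) := by
    have := P.smooth_psi.continuous
    fun_prop
  refine hF.bdd_mul (c := 1) hc.aestronglyMeasurable (ae_of_all _ fun ξ => ?_)
  have := P.mem_psi (c * ξ)
  rw [Complex.norm_real, Real.norm_of_nonneg this.1]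
  exact this.2

lemma aux_block (P : LPPair) (N : ℕ) (hN : 1 ≤ N) (H : ℝ → ℂ) (hc : Continuous H)
    (hi : Integrable H) (hFi : Integrable (𝓕 H))
    (hs : ∀ ξ, 𝓕 H ξ ≠ 0 → (2:ℝ)^(N+3)/6 < |ξ| ∧ |ξ| < 3/8 * (2:ℝ)^(N+3)) (p : ℝ≥0∞) (hp : 1 ≤ p) :
    eLpNorm H p volume ≤ eLpNorm (P.block ((N:ℤ)+1) H) p volume
      + eLpNorm (P.block (N:ℤ) H) p volume := by
  have b1 : P.block ((N:ℤ)+1) H = 𝓕⁻ (fun ξ => (P.ψ ((2:ℝ) ^ (-((N:ℤ)+1)) * ξ) : ℂ) * 𝓕 H ξ) := by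
    unfold LPPair.block
    rw [if_neg (by omega), if_neg (by omega)]
  have b2 : P.block (N:ℤ) H = 𝓕⁻ (fun ξ => (P.ψ ((2:ℝ) ^ (-(N:ℤ)) * ξ) : ℂ) * 𝓕 H ξ) := by
    unfold LPPair.block
    rw [if_neg (by omega), if_neg (by omega)]
  have i1 := aux_psi_int P ((2:ℝ) ^ (-((N:ℤ)+1))) _ hFi
  have i2 := aux_psi_int P ((2:ℝ) ^ (-(N:ℤ))) _ hFi
  have hsum : H = P.block ((N:ℤ)+1) H + P.block (N:ℤ) H := by
    conv_lhs => rw [← hc.fourierInv_fourier_eq hi hFi]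
    rw [b1, b2]
    ext x
    rw [Pi.add_apply, Real.fourierInv_eq, Real.fourierInv_eq, Real.fourierInv_eq,
      ← integral_add]
    · congr 1
      ext ξ
      rw [← smul_add, ← add_mul]
      by_cases h : 𝓕 H ξ = 0
      · simp [h]
      · have := aux_sum P N hN ξ (hs ξ h).1 (hs ξ h).2
        rw [← Complex.ofReal_add, this]
        simp
    · simpa using (Real.fourierIntegral_convergent_iff (-x)).2 i1
    · simpa using (Real.fourierIntegral_convergent_iff (-x)).2 i2
  conv_lhs => rw [hsum]
  refine eLpNorm_add_le ?_ ?_ hp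
  · rw [b1]; exact (aux_fourierInv_cont _ i1).aestronglyMeasurable
  · rw [b2]; exact (aux_fourierInv_cont _ i2).aestronglyMeasurable

lemma aux_lnorm (r : ℝ≥0∞) (hr : 1 ≤ r) (a : ℤ → ℝ≥0∞) (j : ℤ) : a j ≤ lnorm r a := by
  unfold lnorm
  split_ifs with h
  · exact le_iSup a j
  · have hr0 : 0 < r.toReal := ENNReal.toReal_pos (by positivity) h
    calc a j = (a j ^ r.toReal) ^ (1 / r.toReal) := by
          rw [← ENNReal.rpow_mul, mul_one_div_cancel hr0.ne', ENNReal.rpow_one]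
      _ ≤ _ := ENNReal.rpow_le_rpow (ENNReal.le_tsum j) (by positivity)

lemma aux_hfun (k : ℕ) (hk : 1 ≤ k) (s : ℝ) (Φ : SchwartzMap ℝ ℝ) (n : ℕ) (x : ℝ) :
    hfun k s Φ n x = (2:ℝ) ^ (-((n:ℝ)*s)) *
      ((12/17)^(k-1) * (Φ x ^ (k+1) * Real.cos (17/12 * 2^n * x)) +
        (2:ℝ)⁻¹ ^ n * ((12/17)^k * (Φ x ^ k * deriv Φ x) * Real.sin (17/12 * 2^n * x))) := by
  have hd : deriv (fHigh s Φ n) x = (2:ℝ) ^ (-((n:ℝ)*s)) * deriv Φ x * Real.sin (17/12 * 2^n * x)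
      + (2:ℝ) ^ (-((n:ℝ)*s)) * Φ x * (Real.cos (17/12 * 2^n * x) * (17/12 * 2^n)) := by
    have h1 : HasDerivAt (fun x : ℝ => 17/12 * (2:ℝ)^n * x) (17/12 * 2^n) x := by
      simpa using (hasDerivAt_id x).const_mul (17/12 * (2:ℝ)^n)
    exact (((Φ.hasDerivAt x).const_mul _).mul h1.sin).deriv
  have hg : gLow k Φ n x ^ k = (12/17)^k * (2:ℝ)⁻¹ ^ n * Φ x ^ k := by
    unfold gLow
    rw [mul_pow, mul_pow]
    congr 2
    rw [← Real.rpow_natCast, ← Real.rpow_mul (by norm_num), inv_pow, ← Real.rpow_natCast,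
      ← Real.rpow_neg (by norm_num)]
    congr 1
    have : (k:ℝ) ≠ 0 := by positivity
    field_simp
  unfold hfun
  rw [hd, hg]
  obtain ⟨k, rfl⟩ : ∃ m, k = m + 1 := ⟨k - 1, by omega⟩
  have h2 : (2:ℝ)⁻¹ ^ n * 2 ^ n = 1 := by rw [← mul_pow]; norm_num
  simp only [Nat.add_sub_cancel]
  linear_combination ((2:ℝ) ^ (-((n:ℝ)*s)) * (12/17)^k * Φ x ^ (k+1) * Φ x * Real.cos (17/12 * 2^n * x)) * h2

lemma aux_lower (P : LPPair) (k : ℕ) (hk : 1 ≤ k) (s : ℝ)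
    (Φ : SchwartzMap ℝ ℝ) (hΦ : ∀ ξ, 𝓕 (fun x => (Φ x : ℂ)) ξ ≠ 0 → |ξ| ≤ 1/2) (p : ℝ≥0∞) (hp : 1 ≤ p)
    (N : ℕ) (hN : 1 ≤ N) (hbig : ((k:ℝ)+1)/2 < 1/20 * 2^(N+3)) :
    eLpNorm (hfun k s Φ (N+3)) p volume ≤
      eLpNorm (P.block ((N:ℤ)+1) (fun x => (hfun k s Φ (N+3) x : ℂ))) p volume
      + eLpNorm (P.block (N:ℤ) (fun x => (hfun k s Φ (N+3) x : ℂ))) p volume := by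
  obtain ⟨U, hU, hUs⟩ := aux_cpow Φ hΦ k
  set D : SchwartzMap ℝ ℂ := SchwartzMap.derivCLM ℝ ℂ U with hD
  have hDs : ∀ ξ, 𝓕 (fun x => D x) ξ ≠ 0 → |ξ| ≤ ((k:ℝ)+1)/2 := by
    intro ξ h
    apply hUs
    intro h0
    apply h
    have := Real.fourier_deriv U.integrable U.differentiable D.integrable
    have h3 : (fun x => D x) = deriv U := rfl
    rw [h3, this]
    change 𝓕 (U : ℝ → ℂ) ξ = 0 at h0
    simp [h0]
  have hDx : ∀ x, D x = (k+1) * ((Φ x : ℂ)^k * (deriv Φ x : ℝ)) := by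
    intro x
    have h1 : HasDerivAt (fun x => (Φ x : ℂ)) ((deriv Φ x : ℝ) : ℂ) x := (Φ.hasDerivAt x).ofReal_comp
    have h2 := h1.pow (k+1)
    have h3 : (U : ℝ → ℂ) = (fun x => (Φ x : ℂ)) ^ (k+1) := by ext x; simp [hU]
    have : D x = deriv U x := rfl
    rw [this, h3, h2.deriv]
    push_cast
    ring_nf
    try simp
    try ring
  set l : ℝ := 17/12 * 2^(N+3) with hl
  set A : ℂ := (((2:ℝ) ^ (-(((N+3:ℕ):ℝ)*s)) * (12/17)^(k-1) / 2 : ℝ) : ℂ) with hA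
  set B : ℂ := (((2:ℝ) ^ (-(((N+3:ℕ):ℝ)*s)) * (2:ℝ)⁻¹ ^ (N+3) * (12/17)^k / (k+1) : ℝ) : ℂ) / (2 * Complex.I) with hB
  set Wp : SchwartzMap ℝ ℂ := A • U + B • D with hWp
  set Wm : SchwartzMap ℝ ℂ := A • U - B • D with hWm
  have hF : ∀ (a b : ℂ) (ξ : ℝ), 𝓕 (fun x => (a • U + b • D : SchwartzMap ℝ ℂ) x) ξ ≠ 0 →
      |ξ| ≤ ((k:ℝ)+1)/2 := by
    intro a b ξ h
    by_contra hcon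
    apply h
    have e1 : 𝓕 (fun x => U x) ξ = 0 := by
      by_contra h'; exact hcon (hUs ξ h')
    have e2 : 𝓕 (fun x => D x) ξ = 0 := by
      by_contra h'; exact hcon (hDs ξ h')
    change (𝓕 (a • U + b • D)) ξ = 0
    rw [FourierTransform.fourier_add, FourierTransform.fourier_smul, FourierTransform.fourier_smul]
    change (𝓕 U) ξ = 0 at e1
    change (𝓕 D) ξ = 0 at e2
    simp [e1, e2]
  have hWps : ∀ ξ, 𝓕 (fun x => Wp x) ξ ≠ 0 → |ξ| ≤ ((k:ℝ)+1)/2 := hF A B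
  have hWms : ∀ ξ, 𝓕 (fun x => Wm x) ξ ≠ 0 → |ξ| ≤ ((k:ℝ)+1)/2 := by
    have : Wm = A • U + (-B) • D := by rw [hWm]; simp [sub_eq_add_neg]
    rw [this]; exact hF A (-B)
  set H : ℝ → ℂ := fun x => (hfun k s Φ (N+3) x : ℂ) with hH
  have hHe : H = (fun x : ℝ => Complex.exp ((l * x : ℝ) * Complex.I) * Wp x) +
      (fun x : ℝ => Complex.exp ((-l * x : ℝ) * Complex.I) * Wm x) := by
    ext x
    have e1 : Complex.exp ((l * x : ℝ) * Complex.I) = Real.cos (l*x) + Real.sin (l*x) * Complex.I := by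
      rw [Complex.exp_mul_I]; simp
    have e2 : Complex.exp ((-l * x : ℝ) * Complex.I) = Real.cos (l*x) - Real.sin (l*x) * Complex.I := by
      rw [Complex.exp_mul_I]; simp [sub_eq_add_neg]
    simp only [hH, Pi.add_apply]
    rw [e1, e2, aux_hfun k hk, ← hl]
    simp only [hWp, hWm, add_apply, sub_apply, smul_apply,
      hU, hDx, smul_eq_mul, hA, hB]
    have hk1 : (k:ℂ) + 1 ≠ 0 := by exact_mod_cast (by omega : k + 1 ≠ 0)
    push_cast
    field_simp
    ring
  have hexp : ∀ a : ℝ, Continuous (fun x : ℝ => Complex.exp ((a * x : ℝ) * Complex.I)) := by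
    intro a; fun_prop
  have hint : ∀ (a : ℝ) (W : SchwartzMap ℝ ℂ),
      Integrable (fun x : ℝ => Complex.exp ((a * x : ℝ) * Complex.I) * W x) := by
    intro a W
    refine W.integrable.bdd_mul (c := 1) (hexp a).aestronglyMeasurable (ae_of_all _ fun x => ?_)
    rw [Complex.norm_exp_ofReal_mul_I]
  have hHi : Integrable H := by rw [hHe]; exact (hint _ _).add (hint _ _)
  have hHc : Continuous H := by
    rw [hHe]
    exact ((hexp _).mul Wp.continuous).add ((hexp _).mul Wm.continuous)
  have hFH : 𝓕 H = fun ξ => 𝓕 (fun x => Wp x) (ξ - l/(2*π)) + 𝓕 (fun x => Wm x) (ξ - (-l)/(2*π)) := by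
    ext ξ
    rw [← aux_mod, ← aux_mod, hHe]
    rw [Real.fourier_eq, Real.fourier_eq, Real.fourier_eq, ← integral_add]
    · congr 1; ext x; simp
    · exact (Real.fourierIntegral_convergent_iff ξ).2 (hint _ _)
    · exact (Real.fourierIntegral_convergent_iff ξ).2 (hint _ _)
  have hFi : Integrable (𝓕 H) := by
    rw [hFH]
    have e1 : Integrable (𝓕 (fun x => Wp x)) := (𝓕 Wp).integrable
    have e2 : Integrable (𝓕 (fun x => Wm x)) := (𝓕 Wm).integrable
    exact (e1.comp_sub_right _).add (e2.comp_sub_right _)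
  have hmu1 : 17/12/(2*3.15) * 2^(N+3) < l/(2*π) := by
    have := Real.pi_lt_d2
    have h2 : (0:ℝ) < 2^(N+3) := by positivity
    rw [hl, mul_div_right_comm]
    gcongr
  have hmu2 : l/(2*π) < 17/12/(2*3) * 2^(N+3) := by
    have := Real.pi_gt_three
    have h2 : (0:ℝ) < 2^(N+3) := by positivity
    rw [hl, mul_div_right_comm]
    gcongr
  have h2pos : (0:ℝ) < 2^(N+3) := by positivity
  have hsupp : ∀ ξ, 𝓕 H ξ ≠ 0 → (2:ℝ)^(N+3)/6 < |ξ| ∧ |ξ| < 3/8 * (2:ℝ)^(N+3) := by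
    intro ξ h
    rw [hFH] at h
    have : |ξ - l/(2*π)| ≤ ((k:ℝ)+1)/2 ∨ |ξ - (-l)/(2*π)| ≤ ((k:ℝ)+1)/2 := by
      by_contra hcon
      push Not at hcon
      apply h
      have e1 : 𝓕 (fun x => Wp x) (ξ - l/(2*π)) = 0 := by
        by_contra h'; exact absurd (hWps _ h') (not_le.2 hcon.1)
      have e2 : 𝓕 (fun x => Wm x) (ξ - (-l)/(2*π)) = 0 := by
        by_contra h'; exact absurd (hWms _ h') (not_le.2 hcon.2)
      simp only [e1, e2, add_zero]
    rw [neg_div] at this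
    norm_num at hmu1 hmu2
    rcases this with h | h
    · rw [abs_le] at h
      rw [abs_of_pos (by linarith [h.1])]
      constructor <;> linarith [h.1, h.2]
    · rw [abs_le] at h
      rw [abs_of_neg (by linarith [h.2])]
      constructor <;> linarith [h.1, h.2]
  have := aux_block P N hN H hHc hHi hFi hsupp p hp
  refine le_trans (le_of_eq ?_) this
  exact eLpNorm_congr_norm_ae (ae_of_all _ fun x => by simp [hH])

lemma aux_memLp_mul (V : SchwartzMap ℝ ℝ) (w : ℝ → ℝ) (hw : Continuous w) (hb : ∀ x, |w x| ≤ 1)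
    (p : ℝ≥0∞) : MemLp (fun x => V x * w x) p volume ∧
      eLpNorm (fun x => V x * w x) p volume ≤ eLpNorm V p volume := by
  have hle : ∀ x, ‖V x * w x‖ ≤ ‖V x‖ := fun x => by
    rw [norm_mul]
    exact mul_le_of_le_one_right (norm_nonneg _) (hb x)
  exact ⟨(V.memLp p volume).mono (V.continuous.mul hw).aestronglyMeasurable (ae_of_all _ hle),
    eLpNorm_mono hle⟩

lemma aux_limit (k : ℕ) (hk : 1 ≤ k) (s : ℝ) (p : ℝ) (hp : 1 ≤ p) (Φ : SchwartzMap ℝ ℝ) :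
    Filter.Tendsto
      (fun n : ℕ => (2:ℝ) ^ ((n:ℝ) * s) *
        (eLpNorm (hfun k s (⇑Φ) n) (ENNReal.ofReal p) volume).toReal)
      Filter.atTop
      (nhds ((12/17 : ℝ) ^ (k-1) *
        (1/(2*π) * ∫ x in (0:ℝ)..(2*π), |Real.cos x| ^ p) ^ (1/p) *
        (eLpNorm (fun x => Φ x ^ (k+1)) (ENNReal.ofReal p) volume).toReal)) := by
  have hp0 : 0 < p := by linarith
  have hp1 : 1 ≤ ENNReal.ofReal p := by simpa using hp
  obtain ⟨V, hV⟩ := aux_schw_pow Φ k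
  have hVe : (fun x => Φ x ^ (k+1)) = V := funext fun x => (hV x).symm
  obtain ⟨V0, hV0⟩ := aux_schw_pow Φ (k-1)
  have hkk : k - 1 + 1 = k := by omega
  rw [hkk] at hV0
  let Q : SchwartzMap ℝ ℝ := SchwartzMap.pairing (ContinuousLinearMap.mul ℝ ℝ) V0
    (SchwartzMap.derivCLM ℝ ℝ Φ)
  have hQ : ∀ x, Q x = Φ x ^ k * deriv Φ x := fun x => by
    simp [Q, SchwartzMap.pairing_apply_apply, hV0]
  set l : ℕ → ℝ := fun n => 17/12 * 2^n with hl
  set q : ℝ≥0∞ := ENNReal.ofReal p with hq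
  set f : ℕ → ℝ → ℝ := fun n x => V x * Real.cos (l n * x) with hf
  set g : ℕ → ℝ → ℝ := fun n x => Q x * Real.sin (l n * x) with hg
  have hfm : ∀ n, MemLp (f n) q volume := fun n =>
    (aux_memLp_mul V (fun x => Real.cos (l n * x)) (by fun_prop) (fun x => Real.abs_cos_le_one _) q).1
  have hgm := fun n =>
    aux_memLp_mul Q (fun x => Real.sin (l n * x)) (by fun_prop) (fun x => Real.abs_sin_le_one _) q
  have hh : ∀ n, hfun k s Φ n = (2:ℝ) ^ (-((n:ℝ)*s)) •
      (((12/17:ℝ)^(k-1)) • f n + ((2:ℝ)⁻¹ ^ n * (12/17)^k) • g n) := by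
    intro n
    ext x
    rw [aux_hfun k hk]
    simp only [Pi.smul_apply, Pi.add_apply, smul_eq_mul, hf, hg, hV, hQ, hl]
    ring
  have hlim1 : Tendsto (fun n => (eLpNorm (f n) q volume).toReal) atTop
      (nhds ((1/(2*π) * ∫ x in (0:ℝ)..(2*π), |Real.cos x| ^ p) ^ (1/p) *
        (eLpNorm (fun x => Φ x ^ (k+1)) q volume).toReal)) := by
    have e1 : ∀ y : ℝ, |y ^ (k+1)| ^ p = |y| ^ (((k:ℝ)+1) * p) := fun y => by
      rw [abs_pow, ← Real.rpow_natCast, ← Real.rpow_mul (abs_nonneg _)]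
      push_cast; rfl
    have hk' : (1:ℝ) ≤ k := by exact_mod_cast hk
    have hosc := aux_osc Φ p (((k:ℝ)+1) * p) hp (by nlinarith) l (fun n => by positivity)
      ((tendsto_pow_atTop_atTop_of_one_lt (by norm_num)).const_mul_atTop (by norm_num))
    have hfn : ∀ n, (eLpNorm (f n) q volume).toReal =
        (∫ x, |Φ x| ^ (((k:ℝ)+1) * p) * |Real.cos (l n * x)| ^ p) ^ (1/p) := by
      intro n
      rw [aux_norm_eq p hp _ (hfm n)]
      congr 2
      ext x
      rw [hf]
      simp only
      rw [abs_mul, Real.mul_rpow (abs_nonneg _) (abs_nonneg _), hV, e1]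
    have hfV : (eLpNorm (fun x => Φ x ^ (k+1)) q volume).toReal =
        (∫ x, |Φ x| ^ (((k:ℝ)+1) * p)) ^ (1/p) := by
      rw [aux_norm_eq p hp _ (by rw [hVe]; exact V.memLp _ _)]
      simp_rw [e1]
    rw [hfV, ← Real.mul_rpow (aux_cospos p hp).le (integral_nonneg fun x => by positivity)]
    simp_rw [hfn]
    exact hosc.rpow_const (Or.inr (by positivity))
  have hlim2 : Tendsto (fun n => (eLpNorm (((12/17:ℝ)^(k-1)) • f n) q volume).toReal) atTop
      (nhds ((12/17 : ℝ) ^ (k-1) *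
        (1/(2*π) * ∫ x in (0:ℝ)..(2*π), |Real.cos x| ^ p) ^ (1/p) *
        (eLpNorm (fun x => Φ x ^ (k+1)) q volume).toReal)) := by
    have := hlim1.const_mul ((12/17 : ℝ) ^ (k-1))
    rw [← mul_assoc] at this
    refine this.congr fun n => ?_
    rw [eLpNorm_const_smul, ENNReal.toReal_mul, toReal_enorm, Real.norm_of_nonneg (by positivity)]
  have hlim3 : Tendsto (fun n : ℕ => (2:ℝ)⁻¹ ^ n * (12/17)^k * (eLpNorm Q q volume).toReal) atTop
      (nhds 0) := by
    have := (tendsto_pow_atTop_nhds_zero_of_lt_one (r := (2:ℝ)⁻¹) (by norm_num) (by norm_num)).mul_const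
      ((12/17)^k * (eLpNorm Q q volume).toReal)
    simpa [mul_assoc] using this
  have heq : ∀ n : ℕ, (2:ℝ) ^ ((n:ℝ) * s) * (eLpNorm (hfun k s (⇑Φ) n) q volume).toReal =
      (eLpNorm (((12/17:ℝ)^(k-1)) • f n + ((2:ℝ)⁻¹ ^ n * (12/17)^k) • g n) q volume).toReal := by
    intro n
    rw [hh, eLpNorm_const_smul, ENNReal.toReal_mul, toReal_enorm, Real.norm_of_nonneg (by positivity),
      ← mul_assoc, ← Real.rpow_add (by norm_num)]
    simp
  have hdiff : Tendsto (fun n =>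
      (eLpNorm (((12/17:ℝ)^(k-1)) • f n + ((2:ℝ)⁻¹ ^ n * (12/17)^k) • g n) q volume).toReal -
      (eLpNorm (((12/17:ℝ)^(k-1)) • f n) q volume).toReal) atTop (nhds 0) := by
    refine squeeze_zero_norm (fun n => ?_) hlim3
    refine (aux_norm_add hp1 _ _ ((hfm n).const_smul _) ((hgm n).1.const_smul _)).trans ?_
    rw [eLpNorm_const_smul, ENNReal.toReal_mul, toReal_enorm, Real.norm_of_nonneg (by positivity)]
    gcongr
    · exact (Q.memLp q volume).2.ne
    · exact (hgm n).2
  simp_rw [heq]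
  simpa using hdiff.add hlim2

lemma aux_besov (P : LPPair) (k : ℕ) (hk : 1 ≤ k) (s : ℝ)
    (Φ : SchwartzMap ℝ ℝ) (hΦ : ∀ ξ, 𝓕 (fun x => (Φ x : ℂ)) ξ ≠ 0 → |ξ| ≤ 1/2) (p : ℝ≥0∞) (hp : 1 ≤ p)
    (r : ℝ≥0∞) (hr : 1 ≤ r)
    (N : ℕ) (hN : 1 ≤ N) (hbig : ((k:ℝ)+1)/2 < 1/20 * 2^(N+3)) :
    ENNReal.ofReal ((2:ℝ) ^ (((N+3:ℕ):ℝ) * s)) * eLpNorm (hfun k s Φ (N+3)) p volume ≤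
      ENNReal.ofReal ((2:ℝ) ^ (2*s) + (2:ℝ) ^ (3*s)) * P.besovNormR s p r (hfun k s Φ (N+3)) := by
  have h0 := aux_lower P k hk s Φ hΦ p hp N hN hbig
  set H : ℝ → ℂ := fun x => (hfun k s Φ (N+3) x : ℂ) with hH
  have h1 := aux_lnorm r hr (fun j => ENNReal.ofReal ((2:ℝ) ^ ((j : ℝ) * s)) *
    eLpNorm (P.block j H) p volume) ((N:ℤ)+1)
  have h2 := aux_lnorm r hr (fun j => ENNReal.ofReal ((2:ℝ) ^ ((j : ℝ) * s)) *
    eLpNorm (P.block j H) p volume) (N:ℤ)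
  have e1 : ENNReal.ofReal ((2:ℝ) ^ (((N+3:ℕ):ℝ) * s)) =
      ENNReal.ofReal ((2:ℝ) ^ (2*s)) * ENNReal.ofReal ((2:ℝ) ^ ((((N:ℤ)+1 : ℤ) : ℝ) * s)) := by
    rw [← ENNReal.ofReal_mul (by positivity), ← Real.rpow_add (by norm_num)]
    congr 2; push_cast; ring
  have e2 : ENNReal.ofReal ((2:ℝ) ^ (((N+3:ℕ):ℝ) * s)) =
      ENNReal.ofReal ((2:ℝ) ^ (3*s)) * ENNReal.ofReal ((2:ℝ) ^ (((N:ℤ) : ℝ) * s)) := by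
    rw [← ENNReal.ofReal_mul (by positivity), ← Real.rpow_add (by norm_num)]
    congr 2; push_cast; ring
  unfold LPPair.besovNormR LPPair.besovNorm
  calc _ ≤ ENNReal.ofReal ((2:ℝ) ^ (((N+3:ℕ):ℝ) * s)) * _ := mul_le_mul_right h0 _
    _ = ENNReal.ofReal ((2:ℝ) ^ (2*s)) * (ENNReal.ofReal ((2:ℝ) ^ ((((N:ℤ)+1 : ℤ) : ℝ) * s)) *
          eLpNorm (P.block ((N:ℤ)+1) H) p volume) +
        ENNReal.ofReal ((2:ℝ) ^ (3*s)) * (ENNReal.ofReal ((2:ℝ) ^ (((N:ℤ) : ℝ) * s)) *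
          eLpNorm (P.block (N:ℤ) H) p volume) := by
        rw [mul_add, ← mul_assoc, ← mul_assoc, ← e1, ← e2]
    _ ≤ _ := by
        rw [ENNReal.ofReal_add (by positivity) (by positivity), add_mul]
        gcongr

theorem key_lower_bound
    (P : LPPair) (k : ℕ) (hk : 1 ≤ k) (s : ℝ) (p : ℝ) (hp : 1 ≤ p)
    (Φ : SchwartzMap ℝ ℝ) (φh : ℝ → ℝ)
    (hsm : ContDiff ℝ (⊤ : ℕ∞) φh) (hev : ∀ ξ, φh (-ξ) = φh ξ) (hpos : ∀ ξ, 0 ≤ φh ξ)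
    (hsupp : ∀ ξ, φh ξ ≠ 0 → |ξ| ≤ 1/2) (hone : ∀ ξ, |ξ| ≤ 1/4 → φh ξ = 1)
    (hFT : ∀ ξ, 𝓕 (fun x => (Φ x : ℂ)) ξ = (φh ξ : ℂ)) :
    Filter.Tendsto
      (fun n : ℕ => (2:ℝ) ^ ((n:ℝ) * s) *
        (eLpNorm (hfun k s (⇑Φ) n) (ENNReal.ofReal p) volume).toReal)
      Filter.atTop
      (nhds ((12/17 : ℝ) ^ (k-1) *
        (1/(2*π) * ∫ x in (0:ℝ)..(2*π), |Real.cos x| ^ p) ^ (1/p) *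
        (eLpNorm (fun x => Φ x ^ (k+1)) (ENNReal.ofReal p) volume).toReal)) ∧
    0 < (12/17 : ℝ) ^ (k-1) *
        (1/(2*π) * ∫ x in (0:ℝ)..(2*π), |Real.cos x| ^ p) ^ (1/p) *
        (eLpNorm (fun x => Φ x ^ (k+1)) (ENNReal.ofReal p) volume).toReal ∧
    ∀ r : ℝ≥0∞, 1 ≤ r →
      0 < Filter.liminf
        (fun n : ℕ => P.besovNormR s (ENNReal.ofReal p) r (hfun k s (⇑Φ) n))
        Filter.atTop := by
  have hp1 : 1 ≤ ENNReal.ofReal p := by simpa using hp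
  have hlim := aux_limit k hk s p hp Φ
  have hFT0 : 𝓕 (fun x => (Φ x : ℂ)) (0:ℝ) ≠ 0 := by
    rw [hFT, hone 0 (by norm_num)]; simp
  have hΦ : ∀ ξ, 𝓕 (fun x => (Φ x : ℂ)) ξ ≠ 0 → |ξ| ≤ 1/2 := by
    intro ξ h
    rw [hFT] at h
    exact hsupp ξ (by exact_mod_cast h)
  have hpos' : 0 < (12/17 : ℝ) ^ (k-1) *
        (1/(2*π) * ∫ x in (0:ℝ)..(2*π), |Real.cos x| ^ p) ^ (1/p) *
        (eLpNorm (fun x => Φ x ^ (k+1)) (ENNReal.ofReal p) volume).toReal :=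
    mul_pos (mul_pos (by positivity) (Real.rpow_pos_of_pos (aux_cospos p hp) _))
      (aux_pos Φ k p hp hFT0)
  refine ⟨hlim, hpos', fun r hr => ?_⟩
  set L := (12/17 : ℝ) ^ (k-1) *
        (1/(2*π) * ∫ x in (0:ℝ)..(2*π), |Real.cos x| ^ p) ^ (1/p) *
        (eLpNorm (fun x => Φ x ^ (k+1)) (ENNReal.ofReal p) volume).toReal with hL
  have hev1 := hlim.eventually (lt_mem_nhds (half_lt_self hpos'))
  have hK : (0:ℝ) < (2:ℝ) ^ (2*s) + (2:ℝ) ^ (3*s) := by positivity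
  have hc : 0 < ENNReal.ofReal (L/2) / ENNReal.ofReal ((2:ℝ) ^ (2*s) + (2:ℝ) ^ (3*s)) :=
    ENNReal.div_pos (by simpa using hpos') ENNReal.ofReal_ne_top
  refine lt_of_lt_of_le hc (Filter.le_liminf_of_le (by isBoundedDefault) ?_)
  have hev2 : ∀ᶠ n : ℕ in atTop, ((k:ℝ)+1)/2 < 1/20 * 2^n :=
    ((tendsto_pow_atTop_atTop_of_one_lt (by norm_num : (1:ℝ) < 2)).const_mul_atTop
      (by norm_num : (0:ℝ) < 1/20)).eventually_gt_atTop _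
  filter_upwards [hev1, hev2, eventually_ge_atTop 4] with n h1 h2 h3
  obtain ⟨N, rfl⟩ : ∃ N, n = N + 3 := ⟨n - 3, by omega⟩
  have := aux_besov P k hk s Φ hΦ _ hp1 r hr N (by omega) h2
  refine ENNReal.div_le_of_le_mul' (le_trans ?_ this)
  refine (ENNReal.ofReal_le_ofReal h1.le).trans ?_
  rw [ENNReal.ofReal_mul (by positivity)]
  gcongr
  exact ENNReal.ofReal_toReal_le

end
end
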